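/- arXiv:2010.08999 — 10 statements merged into one kernel-verified Lean document; each statement's English description precedes it below -/
import Mathlib

section
/- Let M > 0 and let (d_j)_{j≥0} and (g_j)_{j≥0} be sequences of nonnegative real numbers with d_0 > 0 such that for all j ≥ 0: d_{j+1} ≤ d_j − g_j²/M and g_j ≥ d_j. Then for all j ≥ 0, d_j ≤ M/(j + M/d_0); in particular d_j < M/j for all j ≥ 1. -/
/-- A decrease of at least `d ^ 2 / M` improves the bound `M / t` to `M / (t + 1)`. -/
theorem le_div_add_one_of_le_sub_sq_div {M d d' t : ℝ} (hM : 0 < M) (hd' : 0 ≤ d')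
    (ht : 0 < t) (hstep : d' ≤ d - d ^ 2 / M) (h : d ≤ M / t) : d' ≤ M / (t + 1) := by
  rw [le_div_iff₀ ht] at h
  rw [le_div_iff₀ (by positivity)]
  have hmul : M * d' ≤ d * (M - d) := by
    calc M * d' ≤ M * (d - d ^ 2 / M) := by gcongr
      _ = d * (M - d) := by field_simp
  have hdM : d ≤ M := by
    by_contra! hlt
    nlinarith [mul_nonneg hM.le hd', mul_pos (hM.trans hlt) (sub_pos.2 hlt)]
  refine le_of_mul_le_mul_left ?_ hM
  calc M * (d' * (t + 1)) = M * d' * (t + 1) := by ring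
    _ ≤ d * (M - d) * (t + 1) := by gcongr
    _ = (M - d) * (d * t + d) := by ring
    _ ≤ (M - d) * (M + d) := by
      have := sub_nonneg.2 hdM
      gcongr
    _ ≤ M * M := by nlinarith [sq_nonneg d]

theorem fw_gap_sequence_rate (M : ℝ) (hM : 0 < M) (d g : ℕ → ℝ)
    (hd_nonneg : ∀ j, 0 ≤ d j) (hg_nonneg : ∀ j, 0 ≤ g j)
    (hd0 : 0 < d 0)
    (hstep : ∀ j, d (j + 1) ≤ d j - (g j)^2 / M)
    (hge : ∀ j, g j ≥ d j) :
    (∀ j : ℕ, d j ≤ M / (j + M / d 0)) ∧ (∀ j : ℕ, 1 ≤ j → d j < M / j) := by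
  have hpos : 0 < M / d 0 := by positivity
  have hrate : ∀ j : ℕ, d j ≤ M / (j + M / d 0) := by
    intro j
    induction j with
    | zero => simp [div_div_cancel₀ hM.ne']
    | succ j ih =>
      have hsq : d j ^ 2 / M ≤ g j ^ 2 / M := by
        have := hd_nonneg j
        have := hge j
        gcongr
      have key := le_div_add_one_of_le_sub_sq_div hM (hd_nonneg (j + 1))
        (by positivity) (by linarith [hstep j]) ih
      rwa [add_right_comm, ← Nat.cast_add_one] at key
  refine ⟨hrate, fun j hj => (hrate j).trans_lt ?_⟩
  have hj' : (0 : ℝ) < j := by exact_mod_cast hj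
  exact div_lt_div_of_pos_left hM hj' (by linarith)
end

section
/- Let M > 0 and let (d_j)_{j≥0} and (g_j)_{j≥0} be sequences of nonnegative real numbers with d_0 > 0 such that for all j ≥ 0: d_{j+1} ≤ d_j − g_j²/M and g_j ≥ d_j. Then for all j ≥ 1, min{g_0, g_1, …, g_j} < 2M/j. -/
/-- The `O(1/k)` decay of a nonnegative sequence with quadratic decrease. -/
lemma succ_mul_le_of_quadratic_decrease {M : ℝ} (hM : 0 < M) {d : ℕ → ℝ}
    (hd : ∀ j, 0 ≤ d j) (hstep : ∀ j, d (j + 1) ≤ d j - (d j) ^ 2 / M) (k : ℕ) :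
    ((k : ℝ) + 1) * d k ≤ M := by
  have hstep' (j : ℕ) : M * d (j + 1) ≤ M * d j - (d j) ^ 2 := by
    have h := mul_le_mul_of_nonneg_left (hstep j) hM.le
    rwa [mul_sub, mul_div_cancel₀ _ hM.ne'] at h
  induction k with
  | zero =>
    by_contra! h
    have h0 := hstep' 0
    have h1 := mul_nonneg hM.le (hd 1)
    norm_num at h h0
    nlinarith
  | succ k ih =>
    have hk : (0 : ℝ) ≤ k := k.cast_nonneg
    have hdM : d k ≤ M := by nlinarith [mul_nonneg hk (hd k)]
    have hprod := mul_nonneg (sub_nonneg.2 ih) (sub_nonneg.2 hdM)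
    have h := mul_le_mul_of_nonneg_left (hstep' k) (by positivity : (0 : ℝ) ≤ k + 2)
    push_cast
    refine le_of_mul_le_mul_left ?_ hM
    nlinarith [sq_nonneg (d k)]

/-- Telescoping a decrease that is bounded below on a window. -/
lemma add_mul_le_of_decrease {d : ℕ → ℝ} {a : ℝ} {k n : ℕ}
    (h : ∀ i < n, d (k + i + 1) ≤ d (k + i) - a) : d (k + n) + n * a ≤ d k := by
  induction n with
  | zero => simp
  | succ n ih =>
    have h1 := ih fun i hi => h i (by omega)
    have h2 := h n (by omega)
    rw [← add_assoc]
    push_cast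
    linarith

theorem fw_gap_min_rate (M : ℝ) (hM : 0 < M) (d g : ℕ → ℝ)
    (hd_nonneg : ∀ j, 0 ≤ d j) (hg_nonneg : ∀ j, 0 ≤ g j)
    (hd0 : 0 < d 0)
    (hstep : ∀ j, d (j + 1) ≤ d j - (g j)^2 / M)
    (hge : ∀ j, g j ≥ d j) :
    ∀ j : ℕ, 1 ≤ j →
      (Finset.range (j + 1)).inf' (Finset.nonempty_range_iff.mpr (Nat.succ_ne_zero j)) g
        < 2 * M / j := by
  intro j hj
  by_contra! hcon
  have hj0 : (0 : ℝ) < j := by exact_mod_cast hj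
  have hc (i : ℕ) (hi : i < j + 1) : 2 * M / j ≤ g i :=
    (Finset.le_inf'_iff _ _).1 hcon i (Finset.mem_range.2 hi)
  obtain ⟨k, n, hkn, hlt⟩ : ∃ k n : ℕ, k + n = j + 1 ∧ j ^ 2 < 4 * n * (k + 1) := by
    refine ⟨j / 2, j + 1 - j / 2, by omega, ?_⟩
    have h1 : j + 1 ≤ 2 * (j / 2 + 1) := by omega
    have h2 : j + 1 ≤ 2 * (j + 1 - j / 2) := by omega
    nlinarith [Nat.mul_le_mul h1 h2]
  have hrate := succ_mul_le_of_quadratic_decrease hM hd_nonneg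
    (fun i => (hstep i).trans (by have := hd_nonneg i; have := hge i; gcongr)) k
  have hsum : d (k + n) + n * ((2 * M / j) ^ 2 / M) ≤ d k :=
    add_mul_le_of_decrease fun i hi => (hstep (k + i)).trans (by
      have := hc (k + i) (by omega)
      gcongr)
  have hsq : (2 * M / j) ^ 2 / M = 4 * M / (j : ℝ) ^ 2 := by
    field_simp
    norm_num
  rw [hsq] at hsum
  have hlt' : (j : ℝ) ^ 2 < 4 * n * (k + 1) := by exact_mod_cast hlt
  have hbound : ((k : ℝ) + 1) * (n * (4 * M / (j : ℝ) ^ 2)) ≤ M :=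
    (mul_le_mul_of_nonneg_left (by linarith [hd_nonneg (k + n)]) (by positivity)).trans hrate
  have heq : ((k : ℝ) + 1) * (n * (4 * M / (j : ℝ) ^ 2)) = 4 * n * (k + 1) * M / (j : ℝ) ^ 2 := by
    ring
  rw [heq, div_le_iff₀ (by positivity)] at hbound
  nlinarith
end

section
/- Let H be an m×m real positive semidefinite symmetric matrix, let u, w ∈ ℝ^m, and let g := −H u. Let θ ≥ 1 and R ≥ 0 be real numbers, and let β ∈ ℝ satisfy |β| ≤ R. Assume: (i) ⟨g, u⟩ = −θ, and (ii) ⟨H w, w⟩ ≤ ⟨g, w⟩². Define G̃ := ⟨g, u − w⟩ and G := G̃ + β, and assume G ≥ 0. Then ⟨H(w − u), w − u⟩ ≤ (G + θ + R)², i.e., the local norm of w − u in the H-inner product is at most G + θ + R. -/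
open Matrix

theorem local_norm_bound {m : ℕ} (H : Matrix (Fin m) (Fin m) ℝ)
    (hH : H.PosSemidef) (u w : Fin m → ℝ) (θ R β : ℝ)
    (hθ : 1 ≤ θ) (hR : 0 ≤ R) (hβ : |β| ≤ R)
    (g : Fin m → ℝ) (hg : g = -(H.mulVec u))
    (hgu : g ⬝ᵥ u = -θ)
    (hw : (H.mulVec w) ⬝ᵥ w ≤ (g ⬝ᵥ w)^2)
    (Gtil G : ℝ) (hGtil : Gtil = g ⬝ᵥ (u - w)) (hG : G = Gtil + β)
    (hGpos : 0 ≤ G) :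
    (H.mulVec (w - u)) ⬝ᵥ (w - u) ≤ (G + θ + R)^2 := by
  have hsymm : H.mulVec w ⬝ᵥ u = H.mulVec u ⬝ᵥ w := by
    have hT : Hᵀ = H := by simpa using hH.isHermitian.eq
    rw [dotProduct_comm, dotProduct_mulVec, ← mulVec_transpose, hT]
  have hexpand : H.mulVec (w - u) ⬝ᵥ (w - u) = H.mulVec w ⬝ᵥ w + 2 * (g ⬝ᵥ w) + θ := by
    rw [hg, neg_dotProduct] at hgu
    rw [hg, neg_dotProduct, mulVec_sub, sub_dotProduct, dotProduct_sub, dotProduct_sub, hsymm]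
    linarith
  rw [dotProduct_sub, hgu] at hGtil
  rw [hexpand]
  obtain ⟨t, ht⟩ : ∃ t, g ⬝ᵥ w = -t := ⟨-(g ⬝ᵥ w), by ring⟩
  rw [ht] at hw hGtil ⊢
  obtain ⟨hβl, hβu⟩ := abs_le.mp hβ
  rcases le_total (θ / 2) t with h | h
  · have hsq : t ^ 2 ≤ (G + θ + R) ^ 2 := pow_le_pow_left₀ (by linarith) (by linarith) 2
    nlinarith
  · have hsq : (2 * θ - t) ^ 2 ≤ (G + θ + R) ^ 2 :=
      pow_le_pow_left₀ (by linarith) (by linarith) 2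
    nlinarith [mul_nonneg (sub_nonneg.mpr h) (by linarith : 0 ≤ 4 * θ - 2)]
end

section
/- Let G > 0 and D > 0 be real numbers and set α* := G/(D(G+D)). Then α*·D < 1, the value −α*·G + ω(α*·D) equals −ω*(G/D), and for every real α with 0 ≤ α < 1/D one has −α·G + ω(α·D) ≥ −ω*(G/D); that is, α* minimizes α ↦ −αG + ω(αD) over [0, 1/D). -/
noncomputable def omegaFn (a : ℝ) : ℝ := -a - Real.log (1 - a)

noncomputable def omegaStar (a : ℝ) : ℝ := a - Real.log (1 + a)

/-- Fenchel–Young inequality for the conjugate pair `omegaFn`, `omegaStar`. -/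
theorem neg_omegaStar_le_neg_mul_add_omegaFn {a t : ℝ} (ha : a < 1) (ht : -1 < t) :
    -omegaStar t ≤ -(a * t) + omegaFn a := by
  have h₁ : 0 < 1 - a := by linarith
  have h₂ : 0 < 1 + t := by linarith
  have h := Real.log_le_sub_one_of_pos (mul_pos h₁ h₂)
  rw [Real.log_mul h₁.ne' h₂.ne'] at h
  unfold omegaFn omegaStar
  linarith

theorem adaptive_step_size_optimal (G D : ℝ) (hG : 0 < G) (hD : 0 < D) :
    let αstar := G / (D * (G + D))
    αstar * D < 1 ∧
    -(αstar * G) + omegaFn (αstar * D) = -(omegaStar (G / D)) ∧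
    ∀ α : ℝ, 0 ≤ α → α < 1 / D →
      -(α * G) + omegaFn (α * D) ≥ -(omegaStar (G / D)) := by
  intro αstar
  have hGD : 0 < G + D := by positivity
  have hstar : αstar * D = G / (G + D) := by
    simp only [αstar]
    field_simp
  refine ⟨?_, ?_, fun α _ hα => ?_⟩
  · rw [hstar, div_lt_one hGD]
    linarith
  · have hinv : 1 - G / (G + D) = (1 + G / D)⁻¹ := by
      field_simp
      ring
    rw [hstar, omegaFn, omegaStar, hinv, Real.log_inv]
    simp only [αstar]
    field_simp
    ring
  · have ht : -1 < G / D := by linarith [div_pos hG hD]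
    have h := neg_omegaStar_le_neg_mul_add_omegaFn ((lt_div_iff₀ hD).mp hα) ht
    rwa [mul_assoc, mul_div_cancel₀ G hD.ne'] at h
end

section
/- Let D and G be real numbers with 0 ≤ D < 1 and G ≥ D²/(1−D). Then G + D + ln(1−D) ≥ G/2; equivalently, ω(D) ≤ G/2. -/
/-- The bound `t ≤ sinh t` at `t = log y`. -/
lemma log_le_half_sub_inv {y : ℝ} (hy : 1 ≤ y) : Real.log y ≤ (y - y⁻¹) / 2 := by
  rw [← Real.sinh_log (by linarith)]
  exact Real.self_le_sinh_iff.mpr (Real.log_nonneg hy)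

theorem full_step_progress (D G : ℝ) (hD0 : 0 ≤ D) (hD1 : D < 1)
    (hG : G ≥ D^2 / (1 - D)) :
    G + D + Real.log (1 - D) ≥ G / 2 := by
  have hu : 0 < 1 - D := by linarith
  have hlog := log_le_half_sub_inv (one_le_inv_iff₀.mpr ⟨hu, by linarith⟩)
  rw [Real.log_inv, inv_inv] at hlog
  have hsplit : D ^ 2 / (1 - D) = (1 - D)⁻¹ - (1 - D) - 2 * D := by
    field_simp
    ring
  linarith
end

section
/- Let a ≥ 1 and let δ₀, δ, δ', G be real numbers satisfying 0 ≤ δ ≤ δ₀, δ ≤ G, G > a, and δ' ≤ δ − ω*(G/(G+a)). Then δ' ≤ (1 − 1/(5.3(δ₀ + a)))·δ. -/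
theorem log_three_halves_le : Real.log (3 / 2) ≤ 43 / 106 := by
  rw [Real.log_le_iff_le_exp (by norm_num)]
  refine le_trans ?_ (Real.sum_le_exp_of_nonneg (by norm_num) 7)
  norm_num [Finset.sum_range_succ, Nat.factorial]

theorem div_le_omegaStar {t : ℝ} (ht : 1 / 2 ≤ t) : t / 5.3 ≤ omegaStar t := by
  have h_tangent : Real.log ((1 + t) / (3 / 2)) ≤ (1 + t) / (3 / 2) - 1 :=
    Real.log_le_sub_one_of_pos (by linarith)
  rw [Real.log_div (by linarith) (by norm_num)] at h_tangent
  have h_log := log_three_halves_le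
  unfold omegaStar
  norm_num
  linarith

theorem linear_contraction_step (a δ₀ δ δ' G : ℝ)
    (ha : 1 ≤ a) (hδ_nonneg : 0 ≤ δ) (hδ : δ ≤ δ₀) (hδG : δ ≤ G)
    (hGa : G > a) (hδ' : δ' ≤ δ - omegaStar (G / (G + a))) :
    δ' ≤ (1 - 1 / (5.3 * (δ₀ + a))) * δ := by
  have h_half : 1 / 2 ≤ G / (G + a) := by
    rw [div_le_div_iff₀ (by norm_num) (by linarith)]
    linarith
  have h_ratio : δ / (δ₀ + a) ≤ G / (G + a) := by
    rw [div_le_div_iff₀ (by linarith) (by linarith)]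
    nlinarith [mul_le_mul_of_nonneg_left hδ (by linarith : 0 ≤ G)]
  have h_omega := div_le_omegaStar h_half
  have h_scaled : δ / (δ₀ + a) / 5.3 ≤ G / (G + a) / 5.3 := by gcongr
  have h_expand : (1 - 1 / (5.3 * (δ₀ + a))) * δ = δ - δ / (δ₀ + a) / 5.3 := by
    have : δ₀ + a ≠ 0 := by linarith
    field_simp
  linarith
end

section
/- Let a ≥ 1 and let G, D be real numbers with 0 < G ≤ a and 0 < D ≤ G + a. Then ω*(G/D) ≥ G²/(12a²). -/
/-- A Padé-type lower bound for `omegaStar` on the nonnegative reals. -/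
lemma three_mul_sq_div_le_omegaStar {s : ℝ} (hs : 0 ≤ s) :
    3 * s ^ 2 / (6 + 4 * s) ≤ omegaStar s := by
  let f : ℝ → ℝ := fun x => x - Real.log (1 + x) - 3 * x ^ 2 / (6 + 4 * x)
  have hderiv : ∀ x : ℝ, 0 ≤ x →
      HasDerivAt f (x ^ 3 / ((1 + x) * (3 + 2 * x) ^ 2)) x := by
    intro x hx
    have h₁ : 1 + x ≠ 0 := by positivity
    have h₂ : 6 + 4 * x ≠ 0 := by positivity
    have h₃ : 3 + 2 * x ≠ 0 := by positivity
    have hlog := ((hasDerivAt_id x).const_add 1).log h₁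
    have hquot := (((hasDerivAt_id x).pow 2).const_mul 3).div
      (((hasDerivAt_id x).const_mul 4).const_add 6) h₂
    refine (((hasDerivAt_id x).sub hlog).sub hquot).congr_deriv ?_
    simp only [id, Pi.pow_apply]
    rw [show 6 + 4 * x = 2 * (3 + 2 * x) by ring]
    field_simp
    ring
  have hmono : MonotoneOn f (Set.Ici 0) := by
    refine monotoneOn_of_deriv_nonneg (convex_Ici 0)
      (fun x hx => (hderiv x hx).continuousAt.continuousWithinAt) ?_ ?_
    all_goals
      intro x hx
      rw [interior_Ici, Set.mem_Ioi] at hx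
    · exact (hderiv x hx.le).differentiableAt.differentiableWithinAt
    · rw [(hderiv x hx.le).deriv]
      positivity
  have h := hmono Set.self_mem_Ici hs hs
  simp only [f, omegaStar] at h ⊢
  norm_num at h
  linarith

theorem small_gap_progress (a G D : ℝ) (ha : 1 ≤ a)
    (hG0 : 0 < G) (hGa : G ≤ a) (hD0 : 0 < D) (hD : D ≤ G + a) :
    omegaStar (G / D) ≥ G^2 / (12 * a^2) := by
  refine le_trans ?_ (three_mul_sq_div_le_omegaStar (div_pos hG0 hD0).le)
  have hpade : 3 * (G / D) ^ 2 / (6 + 4 * (G / D)) = G ^ 2 / (D * (6 * D + 4 * G) / 3) := by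
    field_simp
  rw [hpade]
  have hle : D * (6 * D + 4 * G) ≤ 2 * a * (16 * a) :=
    mul_le_mul (by linarith) (by linarith) (by positivity) (by positivity)
  exact div_le_div_of_nonneg_left (by positivity) (by positivity)
    (by linarith [sq_nonneg a])
end

section
/- Let c be a real number with 5.3·c > 1, let (δ_k)_{k≥0} be a nonincreasing sequence of nonnegative real numbers with δ₀ > 1/10.6, and let S be a finite set of natural numbers such that for every k ∈ S: δ_k > 1/10.6 and δ_{k+1} ≤ (1 − 1/(5.3c))·δ_k. Then the cardinality of S is at most ⌈5.3·c·ln(10.6·δ₀)⌉. -/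
/-- A nonincreasing sequence that contracts by a factor `r` at the indices of `S` has contracted
by `r ^ m` once `m` indices of `S` have been passed. -/
theorem le_pow_card_filter_lt_mul {r : ℝ} (hr : 0 ≤ r) {δ : ℕ → ℝ}
    (hmono : ∀ k, δ (k + 1) ≤ δ k) {S : Finset ℕ} (hS : ∀ k ∈ S, δ (k + 1) ≤ r * δ k) (n : ℕ) :
    δ n ≤ r ^ (S.filter (· < n)).card * δ 0 := by
  induction n with
  | zero => simp
  | succ n ih =>
    by_cases hn : n ∈ S
    · have hfilter : S.filter (· < n + 1) = insert n (S.filter (· < n)) := by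
        ext k
        simp only [Finset.mem_filter, Finset.mem_insert]
        grind
      rw [hfilter, Finset.card_insert_of_notMem (by simp), pow_succ', mul_assoc]
      exact (hS n hn).trans (mul_le_mul_of_nonneg_left ih hr)
    · have hfilter : S.filter (· < n + 1) = S.filter (· < n) := by
        ext k
        simp only [Finset.mem_filter]
        grind
      rw [hfilter]
      exact (hmono n).trans ih

theorem linear_rate_iteration_count (c : ℝ) (hc : 5.3 * c > 1)
    (δ : ℕ → ℝ) (hmono : ∀ k, δ (k + 1) ≤ δ k) (hnonneg : ∀ k, 0 ≤ δ k)
    (hδ0 : δ 0 > 1 / 10.6) (S : Finset ℕ)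
    (hS : ∀ k ∈ S, δ k > 1 / 10.6 ∧ δ (k + 1) ≤ (1 - 1 / (5.3 * c)) * δ k) :
    (S.card : ℤ) ≤ ⌈5.3 * c * Real.log (10.6 * δ 0)⌉ := by
  have hscaled : 1 < 10.6 * δ 0 := by norm_num at hδ0 ⊢; linarith
  generalize 5.3 * c = A at *
  have hA : 0 < A := by linarith
  rcases S.eq_empty_or_nonempty with rfl | hne
  · simpa using Int.ceil_nonneg (mul_nonneg hA.le (Real.log_pos hscaled).le)
  set m := S.max' hne with hm
  have hmS : m ∈ S := S.max'_mem hne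
  have hfilter : S.filter (· < m) = S.erase m := by
    ext k
    simp only [Finset.mem_filter, Finset.mem_erase]
    have := S.le_max' k
    grind
  have hcard : (S.filter (· < m)).card + 1 = S.card := by
    rw [hfilter, Finset.card_erase_add_one hmS]
  have hr : 0 ≤ 1 - 1 / A := by
    rw [sub_nonneg, div_le_one hA]
    exact hc.le
  have hbound := le_pow_card_filter_lt_mul hr hmono (fun k hk => (hS k hk).2) m
  generalize (S.filter (· < m)).card = p at *
  have hexp : (1 - 1 / A) ^ p ≤ Real.exp (-(p / A)) := by
    calc (1 - 1 / A) ^ p ≤ Real.exp (-(1 / A)) ^ p :=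
          pow_le_pow_left₀ hr (Real.one_sub_le_exp_neg _) p
      _ = Real.exp (-(p / A)) := by rw [← Real.exp_nat_mul]; ring_nf
  have hlast : 1 / 10.6 < Real.exp (-(p / A)) * δ 0 :=
    (hS m hmS).1.trans_le (hbound.trans (mul_le_mul_of_nonneg_right hexp (hnonneg 0)))
  have hlt : Real.exp (p / A) < 10.6 * δ 0 := by
    rw [Real.exp_neg, inv_mul_eq_div, lt_div_iff₀ (Real.exp_pos _)] at hlast
    norm_num at hlast ⊢
    linarith
  have hlog : (p : ℝ) < A * Real.log (10.6 * δ 0) := by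
    rw [mul_comm, ← div_lt_iff₀ hA]
    exact (Real.lt_log_iff_exp_lt (by linarith)).2 hlt
  have hceil : (p : ℤ) < ⌈A * Real.log (10.6 * δ 0)⌉ := Int.lt_ceil.2 (by exact_mod_cast hlog)
  omega
end

section
/- Let a ≥ 1 and ε > 0 be real numbers, and let (δ_k)_{k≥0} be a nonincreasing sequence of nonnegative real numbers with δ₀ > ε. Suppose that for every k ≥ 0 at least one of the following holds: (i) δ_k > 1/10.6 and δ_{k+1} ≤ (1 − 1/(5.3(δ₀ + a)))·δ_k, or (ii) 12a²·(δ_k − δ_{k+1}) ≥ δ_k·δ_{k+1}. Then, letting K := max(⌈5.3(δ₀ + a)·ln(10.6·δ₀)⌉, 0) + ⌈12a²·(1/ε − 1/δ₀)⌉, one has δ_K ≤ ε. -/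
/-- Along a positive nonincreasing sequence whose steps either contract by `1 - 1 / C` above the
threshold `1 / t`, or increase the reciprocal by `1 / D`, the first `k` steps split into `m`
contractions and `n` reciprocal increases, where `m` is bounded by `⌈C * log (t * δ 0)⌉₊`. -/
theorem exists_contraction_reciprocal_split {C D t : ℝ} (hC : 0 < C) (hD : 0 < D) (ht : 0 < t)
    {δ : ℕ → ℝ} (hmono : ∀ k, δ (k + 1) ≤ δ k)
    (hstep : ∀ k, (δ k > 1 / t ∧ δ (k + 1) ≤ (1 - 1 / C) * δ k)
      ∨ D * (δ k - δ (k + 1)) ≥ δ k * δ (k + 1)) (k : ℕ) (hk : 0 < δ k) :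
    ∃ m n : ℕ, m + n = k ∧ 1 / δ 0 + n / D ≤ 1 / δ k ∧
      Real.log (δ k) ≤ Real.log (δ 0) - m / C ∧
      (m : ℤ) ≤ max ⌈C * Real.log (t * δ 0)⌉ 0 := by
  induction k with
  | zero => exact ⟨0, 0, by simp⟩
  | succ k ih =>
    have hpos : 0 < δ k := hk.trans_le (hmono k)
    have h0 : 0 < δ 0 := hpos.trans_le (antitone_nat_of_succ_le hmono (Nat.zero_le k))
    obtain ⟨m, n, hmn, hrec, hlog, hm⟩ := ih hpos
    rcases hstep k with ⟨hthr, hcontr⟩ | hinc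
    · refine ⟨m + 1, n, by omega, hrec.trans (one_div_le_one_div_of_le hk (hmono k)), ?_, ?_⟩
      · have hq : 0 < 1 - 1 / C := pos_of_mul_pos_left (hk.trans_le hcontr) hpos.le
        have h1 := Real.log_le_log hk hcontr
        rw [Real.log_mul hq.ne' hpos.ne'] at h1
        have h2 := Real.log_le_sub_one_of_pos hq
        push_cast
        rw [add_div]
        linarith
      · have h1 : 1 < t * δ k := by
          rw [gt_iff_lt, div_lt_iff₀ ht] at hthr
          linarith
        have h2 := Real.log_pos h1
        rw [Real.log_mul ht.ne' hpos.ne'] at h2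
        have h3 : (m : ℝ) / C < Real.log (t * δ 0) := by
          rw [Real.log_mul ht.ne' h0.ne']
          linarith
        rw [div_lt_iff₀' hC] at h3
        have h4 : (m : ℤ) < ⌈C * Real.log (t * δ 0)⌉ := Int.lt_ceil.2 (by exact_mod_cast h3)
        exact le_max_of_le_left (by push_cast; omega)
    · refine ⟨m, n + 1, by omega, ?_, ?_, hm⟩
      · have h1 : 1 / D ≤ 1 / δ (k + 1) - 1 / δ k := by
          rw [div_sub_div _ _ hk.ne' hpos.ne', div_le_div_iff₀ hD (mul_pos hk hpos)]
          linarith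
        push_cast
        rw [add_div]
        linarith
      · exact (Real.log_le_log hk (hmono k)).trans hlog

theorem optimality_gap_complexity (a ε : ℝ) (ha : 1 ≤ a) (hε : 0 < ε)
    (δ : ℕ → ℝ) (hmono : ∀ k, δ (k + 1) ≤ δ k) (hnonneg : ∀ k, 0 ≤ δ k)
    (hδ0 : δ 0 > ε)
    (hstep : ∀ k, (δ k > 1 / 10.6 ∧ δ (k + 1) ≤ (1 - 1 / (5.3 * (δ 0 + a))) * δ k)
      ∨ 12 * a^2 * (δ k - δ (k + 1)) ≥ δ k * δ (k + 1)) :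
    ∀ K : ℤ, K = max ⌈5.3 * (δ 0 + a) * Real.log (10.6 * δ 0)⌉ 0
        + ⌈12 * a^2 * (1 / ε - 1 / δ 0)⌉ →
      δ K.toNat ≤ ε := by
  intro K hK
  by_contra! hlt
  have hC : 0 < 5.3 * (δ 0 + a) := mul_pos (by norm_num) (by linarith)
  have hD : 0 < 12 * a ^ 2 := by positivity
  obtain ⟨m, n, hmn, hrec, -, hm⟩ := exists_contraction_reciprocal_split hC hD
    (by norm_num) hmono hstep K.toNat (hε.trans hlt)
  have hn : ⌈12 * a ^ 2 * (1 / ε - 1 / δ 0)⌉ ≤ (n : ℤ) := by omega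
  have hn' : 12 * a ^ 2 * (1 / ε - 1 / δ 0) ≤ n := by exact_mod_cast Int.ceil_le.1 hn
  rw [← le_div_iff₀' hD] at hn'
  have := one_div_lt_one_div_of_lt hε hlt
  linarith
end

section
/- Let a ≥ 1 and ε > 0 be real numbers, let (δ_k)_{k≥0} be a nonincreasing sequence of nonnegative real numbers, and let (G_k)_{k≥0} be a sequence of real numbers with G_k ≥ δ_k for all k. Suppose that for every k ≥ 0 at least one of the following holds: (i) δ_k > 1/10.6 and δ_{k+1} ≤ (1 − 1/(5.3(δ₀ + a)))·δ_k, or (ii) G_k ≤ a and δ_{k+1} ≤ δ_k − G_k²/(12a²). Then, letting K := max(⌈5.3(δ₀ + a)·ln(10.6·δ₀)⌉, 0) + ⌈24a²/ε⌉, there exists k with 0 ≤ k ≤ K such that G_k ≤ ε. -/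
/-- One step `y ≤ x - x² / c` improves the bound `n x ≤ c` to `(n + 1) y ≤ c`. -/
lemma succ_mul_le_of_quadratic_decrease_s16 {c x y n : ℝ} (hc : 0 < c) (hn : 0 ≤ n) (hxc : x ≤ c)
    (hnx : n * x ≤ c) (hy : y ≤ x - x ^ 2 / c) : (n + 1) * y ≤ c := by
  obtain ⟨z, rfl⟩ : ∃ z, x = c * z := ⟨x / c, by field_simp⟩
  have hz : z ≤ 1 := by nlinarith
  have hnz : n * z ≤ 1 := by nlinarith
  have hyz : y ≤ c * (z - z ^ 2) := hy.trans_eq (by field_simp)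
  have hz' : (n + 1) * (z - z ^ 2) ≤ 1 := by nlinarith [sq_nonneg z]
  calc (n + 1) * y ≤ (n + 1) * (c * (z - z ^ 2)) := by gcongr
    _ = c * ((n + 1) * (z - z ^ 2)) := by ring
    _ ≤ c := by nlinarith

/-- If a quantity bounded by `d * exp (-n / L)` still exceeds `1 / b`, then `n < L * log (b * d)`. -/
lemma lt_mul_log_of_lt_mul_exp {L b d x n : ℝ} (hL : 0 < L) (hb : 0 < b) (hx : 1 / b < x)
    (hxd : x ≤ d * Real.exp (-n / L)) : n < L * Real.log (b * d) := by
  have h : 1 / b < d * Real.exp (-n / L) := hx.trans_le hxd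
  have h1 : Real.exp (n / L) < b * d := by
    rw [neg_div, Real.exp_neg, ← div_eq_mul_inv, div_lt_div_iff₀ hb (Real.exp_pos _)] at h
    linarith
  have h2 : n / L < Real.log (b * d) := (Real.lt_log_iff_exp_lt ((Real.exp_pos _).trans h1)).2 h1
  rw [div_lt_iff₀ hL] at h2
  linarith

/-- Along the first `k` steps, `n` of them linear contractions and `m` of them quadratic decreases,
the optimality gap obeys the accumulated bounds of both kinds. -/
lemma exists_step_counts {c ε L b : ℝ} {N : ℤ} {δ G : ℕ → ℝ} {T : ℕ} (hc : 0 < c) (hε : 0 < ε)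
    (hL : 0 < L) (hb : 0 < b) (hN : max ⌈L * Real.log (b * δ 0)⌉ 0 = N)
    (hmono : ∀ k, δ (k + 1) ≤ δ k) (hnonneg : ∀ k, 0 ≤ δ k) (hGδ : ∀ k, δ k ≤ G k)
    (hstep : ∀ k, (1 / b < δ k ∧ δ (k + 1) ≤ (1 - 1 / L) * δ k)
      ∨ (G k ≤ c ∧ δ (k + 1) ≤ δ k - (G k) ^ 2 / c))
    (hG : ∀ k < T, ε < G k) :
    ∀ k ≤ T, ∃ n m : ℕ, n + m = k ∧ (n : ℤ) ≤ N ∧ δ k ≤ δ 0 * Real.exp (-n / L) ∧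
      ∀ s t : ℕ, s + t = m → s * (δ k + t * (ε ^ 2 / c)) ≤ c := by
  intro k
  induction k with
  | zero =>
    refine fun _ ↦ ⟨0, 0, rfl, by simp [← hN], by simp, fun s t hst ↦ ?_⟩
    obtain rfl : s = 0 := by omega
    simpa using hc.le
  | succ k ih =>
    intro hk
    obtain ⟨n, m, hnm, hn, hexp, hpot⟩ := ih (by omega)
    rcases hstep k with ⟨hbig, hdec⟩ | ⟨hGc, hdec⟩
    · refine ⟨n + 1, m, by omega, ?_, ?_, fun s t hst ↦ (hpot s t hst).trans' ?_⟩
      · have hlt : (n : ℤ) < ⌈L * Real.log (b * δ 0)⌉ :=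
          Int.lt_ceil.2 (by exact_mod_cast lt_mul_log_of_lt_mul_exp hL hb hbig hexp)
        push_cast
        omega
      · have hcontr : 1 - 1 / L ≤ Real.exp (-1 / L) := by
          have := Real.add_one_le_exp (-1 / L)
          rw [neg_div] at *
          linarith
        calc δ (k + 1) ≤ (1 - 1 / L) * δ k := hdec
          _ ≤ Real.exp (-1 / L) * δ k := mul_le_mul_of_nonneg_right hcontr (hnonneg k)
          _ ≤ Real.exp (-1 / L) * (δ 0 * Real.exp (-n / L)) := by gcongr
          _ = δ 0 * Real.exp (-(n + 1 : ℕ) / L) := by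
            rw [mul_left_comm, ← Real.exp_add]
            congr 2
            push_cast
            ring
      · gcongr
        exact hmono k
    · refine ⟨n, m + 1, by omega, hn, (hmono k).trans hexp, fun s t hst ↦ ?_⟩
      cases t with
      | zero =>
        obtain rfl : s = m + 1 := by omega
        have hm : (m : ℝ) * δ k ≤ c := by simpa using hpot m 0 rfl
        have hsq : δ k ^ 2 / c ≤ G k ^ 2 / c := by
          have := hGδ k
          have := hnonneg k
          gcongr
        simpa using succ_mul_le_of_quadratic_decrease_s16 hc m.cast_nonneg ((hGδ k).trans hGc) hm
          (y := δ (k + 1)) (by linarith)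
      | succ t =>
        refine (hpot s t (by omega)).trans' ?_
        have hsq : ε ^ 2 / c ≤ G k ^ 2 / c := by
          have := (hG k (by omega)).le
          gcongr
        gcongr ?_ * ?_
        push_cast
        linarith

theorem fw_gap_complexity (a ε : ℝ) (ha : 1 ≤ a) (hε : 0 < ε)
    (δ G : ℕ → ℝ) (hmono : ∀ k, δ (k + 1) ≤ δ k) (hnonneg : ∀ k, 0 ≤ δ k)
    (hGδ : ∀ k, G k ≥ δ k)
    (hstep : ∀ k, (δ k > 1 / 10.6 ∧ δ (k + 1) ≤ (1 - 1 / (5.3 * (δ 0 + a))) * δ k)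
      ∨ (G k ≤ a ∧ δ (k + 1) ≤ δ k - (G k)^2 / (12 * a^2))) :
    ∀ K : ℤ, K = max ⌈5.3 * (δ 0 + a) * Real.log (10.6 * δ 0)⌉ 0
        + ⌈24 * a^2 / ε⌉ →
      ∃ k : ℕ, (k : ℤ) ≤ K ∧ G k ≤ ε := by
  intro K hK
  by_contra! hG
  obtain ⟨N, hN⟩ : ∃ N, max ⌈5.3 * (δ 0 + a) * Real.log (10.6 * δ 0)⌉ 0 = N := ⟨_, rfl⟩
  have hN0 : 0 ≤ N := hN ▸ le_max_right _ _
  obtain ⟨M, hM⟩ : ∃ M, ⌈24 * a ^ 2 / ε⌉ = M := ⟨_, rfl⟩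
  have hM0 : 0 < M := hM ▸ Int.ceil_pos.2 (by positivity)
  have hMle : 24 * a ^ 2 / ε ≤ M := hM ▸ Int.le_ceil _
  rw [hN, hM] at hK
  have hL : 0 < 5.3 * (δ 0 + a) := by linarith [hnonneg 0]
  have hc : 0 < 12 * a ^ 2 := by positivity
  have hac : a ≤ 12 * a ^ 2 := by nlinarith
  obtain ⟨n, m, hnm, hn, -, hpot⟩ := exists_step_counts hc hε hL (by norm_num) hN hmono hnonneg hGδ
    (fun k ↦ (hstep k).imp_right fun h ↦ ⟨h.1.trans hac, h.2⟩) (T := (K + 1).toNat)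
    (fun k hk ↦ hG k (by omega)) _ le_rfl
  have hm : M + 1 ≤ m := by omega
  have hsplit := hpot (m / 2) (m - m / 2) (by omega)
  obtain ⟨s, hs⟩ : ∃ s, m / 2 = s := ⟨_, rfl⟩
  obtain ⟨t, ht⟩ : ∃ t, m - m / 2 = t := ⟨_, rfl⟩
  rw [ht, hs] at hsplit
  have hst : M ^ 2 < 4 * ((s : ℤ) * t) := by
    obtain rfl | rfl : t = s ∨ t = s + 1 := by omega
    · nlinarith [show M + 1 ≤ 2 * (t : ℤ) by omega]
    · push_cast
      nlinarith [show M ≤ 2 * (s : ℤ) by omega]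
  have hst' : (M : ℝ) ^ 2 < 4 * (s * t) := by exact_mod_cast hst
  have hprod : (s * t : ℝ) * (ε ^ 2 / (12 * a ^ 2)) ≤ 12 * a ^ 2 := by
    nlinarith [mul_nonneg (Nat.cast_nonneg (α := ℝ) s) (hnonneg (K + 1).toNat)]
  rw [mul_div_assoc', div_le_iff₀ hc] at hprod
  rw [div_le_iff₀ hε] at hMle
  have hsq : (24 * a ^ 2) ^ 2 ≤ (M * ε) ^ 2 := by gcongr
  nlinarith [mul_lt_mul_of_pos_right hst' (pow_pos hε 2)]
end
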